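/- Every language generated by a capacity-bounded phrase structure grammar (Ginsburg–Spanier) is generated by a context-free matrix grammar of finite index (without erasing rules up to the standard normalization), i.e., GS_cb ⊆ MAT_fin. -/

import Mathlib

/-! Common definitions: symbols, context-free grammars, Ginsburg–Spanier phrase
structure grammars, capacity-bounded derivations, matrix/vector grammars,
finite index, cf Petri nets with place capacities, and language families. -/

inductive Symb (N T : Type) where
  | nt : N → Symb N T
  | tm : T → Symb N T
deriving DecidableEq

namespace CapGram

variable {N T Δ α : Type}

open Classical in
/-- Number of occurrences of the nonterminal `A` in a sentential form. -/
noncomputable def symCount (A : N) : List (Symb N T) → ℕ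
  | [] => 0
  | Symb.nt B :: r => (if B = A then 1 else 0) + symCount A r
  | Symb.tm _ :: r => symCount A r

/-- Total number of nonterminal occurrences in a sentential form. -/
def ntCount : List (Symb N T) → ℕ
  | [] => 0
  | Symb.nt _ :: r => 1 + ntCount r
  | Symb.tm _ :: r => ntCount r

/-- The sentential form `w` respects the capacity function `κ`. -/
def CapOK (κ : N → ℕ) (w : List (Symb N T)) : Prop :=
  ∀ A : N, symCount A w ≤ κ A

/-- A context-free grammar (rules are pairs of a nonterminal and a word). -/
structure CFG (N T : Type) where
  start : N
  rules : Finset (N × List (Symb N T))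

/-- Application of a single context-free rule. -/
def applyRule (r : N × List (Symb N T)) (u v : List (Symb N T)) : Prop :=
  ∃ x y : List (Symb N T), u = x ++ Symb.nt r.1 :: y ∧ v = x ++ r.2 ++ y

def CFG.Step (G : CFG N T) (u v : List (Symb N T)) : Prop :=
  ∃ r ∈ G.rules, applyRule r u v

/-- A derivation step both of whose sentential forms respect the capacity. -/
def CFG.CapStep (G : CFG N T) (κ : N → ℕ) (u v : List (Symb N T)) : Prop :=
  G.Step u v ∧ CapOK κ u ∧ CapOK κ v

/-- A derivation step both of whose sentential forms have at most `k`
nonterminal occurrences in total. -/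
def CFG.IdxStep (G : CFG N T) (k : ℕ) (u v : List (Symb N T)) : Prop :=
  G.Step u v ∧ ntCount u ≤ k ∧ ntCount v ≤ k

/-- The (unrestricted) language of a context-free grammar. -/
def CFG.Lang (G : CFG N T) : Set (List T) :=
  { w | Relation.ReflTransGen G.Step [Symb.nt G.start] (w.map Symb.tm) }

/-- The language of the capacity-bounded grammar `(G, κ)`. -/
def CFG.CapLang (G : CFG N T) (κ : N → ℕ) : Set (List T) :=
  { w | Relation.ReflTransGen (G.CapStep κ) [Symb.nt G.start] (w.map Symb.tm) }

/-- Words with a derivation of index at most `k`. -/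
def CFG.FinLang (G : CFG N T) (k : ℕ) : Set (List T) :=
  { w | Relation.ReflTransGen (G.IdxStep k) [Symb.nt G.start] (w.map Symb.tm) }

/-- A phrase structure grammar due to Ginsburg and Spanier: the left-hand side
of a rule is a nonempty word of nonterminals, encoded as head and tail. -/
structure GSG (N T : Type) where
  start : N
  rules : Finset ((N × List N) × List (Symb N T))

def GSG.Step (G : GSG N T) (u v : List (Symb N T)) : Prop :=
  ∃ r ∈ G.rules, ∃ x y : List (Symb N T),
    u = x ++ (r.1.1 :: r.1.2).map Symb.nt ++ y ∧ v = x ++ r.2 ++ y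

def GSG.CapStep (G : GSG N T) (κ : N → ℕ) (u v : List (Symb N T)) : Prop :=
  G.Step u v ∧ CapOK κ u ∧ CapOK κ v

def GSG.Lang (G : GSG N T) : Set (List T) :=
  { w | Relation.ReflTransGen G.Step [Symb.nt G.start] (w.map Symb.tm) }

def GSG.CapLang (G : GSG N T) (κ : N → ℕ) : Set (List T) :=
  { w | Relation.ReflTransGen (G.CapStep κ) [Symb.nt G.start] (w.map Symb.tm) }

/-- Derivations labeled by their sequence of context-free rules, where every
sentential form (including the first and last) satisfies the invariant `P`. -/
inductive DerivP (P : List (Symb N T) → Prop) :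
    List (N × List (Symb N T)) → List (Symb N T) → List (Symb N T) → Prop
  | nil (u : List (Symb N T)) : P u → DerivP P [] u u
  | cons {r π u v w} : P u → applyRule r u v → DerivP P π v w →
      DerivP P (r :: π) u w

/-- A matrix grammar: a finite set of matrices (sequences of cf rules). -/
structure MG (N T : Type) where
  start : N
  mats : Finset (List (N × List (Symb N T)))

/-- Matrix language: rule sequences are concatenations of matrices. -/
def MG.Lang (G : MG N T) : Set (List T) :=
  { w | ∃ ms : List (List (N × List (Symb N T))),
      (∀ m ∈ ms, m ∈ G.mats) ∧
      DerivP (fun _ => True) ms.flatten [Symb.nt G.start] (w.map Symb.tm) }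

/-- Words with a matrix derivation of index at most `k`. -/
def MG.FinLang (G : MG N T) (k : ℕ) : Set (List T) :=
  { w | ∃ ms : List (List (N × List (Symb N T))),
      (∀ m ∈ ms, m ∈ G.mats) ∧
      DerivP (fun u => ntCount u ≤ k) ms.flatten [Symb.nt G.start] (w.map Symb.tm) }

/-- `Shuffle ms π`: `π` is an interleaving (shuffle) of the lists in `ms`. -/
inductive Shuffle : List (List α) → List α → Prop
  | nil (ms : List (List α)) : (∀ l ∈ ms, l = []) → Shuffle ms []
  | cons {ms₁ : List (List α)} {l : List α} {ms₂ : List (List α)} {π : List α}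
      (a : α) : Shuffle (ms₁ ++ l :: ms₂) π →
      Shuffle (ms₁ ++ (a :: l) :: ms₂) (a :: π)

/-- A vector grammar: like a matrix grammar, but derivations use shuffles. -/
structure VG (N T : Type) where
  start : N
  mats : Finset (List (N × List (Symb N T)))

def VG.Lang (G : VG N T) : Set (List T) :=
  { w | ∃ ms π, (∀ m ∈ ms, m ∈ G.mats) ∧ Shuffle ms π ∧
      DerivP (fun _ => True) π [Symb.nt G.start] (w.map Symb.tm) }

def VG.CapLang (G : VG N T) (κ : N → ℕ) : Set (List T) :=
  { w | ∃ ms π, (∀ m ∈ ms, m ∈ G.mats) ∧ Shuffle ms π ∧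
      DerivP (CapOK κ) π [Symb.nt G.start] (w.map Symb.tm) }

def VG.FinLang (G : VG N T) (k : ℕ) : Set (List T) :=
  { w | ∃ ms π, (∀ m ∈ ms, m ∈ G.mats) ∧ Shuffle ms π ∧
      DerivP (fun u => ntCount u ≤ k) π [Symb.nt G.start] (w.map Symb.tm) }

/-! cf Petri nets: places are in bijection with the nonterminals, transitions
with the rules; firing the transition of rule `A → α` consumes one token from
the place of `A` and adds `|α|_X` tokens to the place of each nonterminal `X`. -/

open Classical in
/-- Firing of the transition corresponding to rule `r`, turning marking `μ`
into marking `μ'`. -/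
noncomputable def ruleFire (r : N × List (Symb N T)) (μ μ' : N → ℕ) : Prop :=
  1 ≤ μ r.1 ∧ ∀ A, μ' A = μ A - (if A = r.1 then 1 else 0) + symCount A r.2

/-- Occurrence sequences of the cf Petri net of `G`, all of whose markings
(including initial and final) satisfy the validity predicate `P`. -/
inductive FireSeqP (G : CFG N T) (P : (N → ℕ) → Prop) :
    List (N × List (Symb N T)) → (N → ℕ) → (N → ℕ) → Prop
  | nil (μ : N → ℕ) : P μ → FireSeqP G P [] μ μ
  | cons {r π μ μ' μ''} : r ∈ G.rules → P μ → ruleFire r μ μ' →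
      FireSeqP G P π μ' μ'' → FireSeqP G P (r :: π) μ μ''

open Classical in
/-- The initial marking: one token on the place of the start symbol. -/
noncomputable def initMark (G : CFG N T) : N → ℕ :=
  fun A => if A = G.start then 1 else 0

/-- The language of `G` controlled by its cf Petri net restricted to markings
satisfying `P` (e.g. a place capacity constraint). -/
def CFG.PNLang (G : CFG N T) (P : (N → ℕ) → Prop) : Set (List T) :=
  { w | ∃ π μ, DerivP (fun _ => True) π [Symb.nt G.start] (w.map Symb.tm) ∧
      FireSeqP G P π (initMark G) μ }

/-! Language families over a terminal alphabet `T`. -/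

/-- Context-free languages of finite index. -/
def CFfin (T : Type) : Set (Set (List T)) :=
  { L | ∃ (N : Type) (_ : Fintype N) (G : CFG N T) (k : ℕ),
      L = G.Lang ∧ G.Lang ⊆ G.FinLang k }

/-- Languages of capacity-bounded context-free grammars. -/
def CFcb (T : Type) : Set (Set (List T)) :=
  { L | ∃ (N : Type) (_ : Fintype N) (G : CFG N T) (κ : N → ℕ),
      L = G.CapLang κ }

/-- Languages of capacity-bounded Ginsburg–Spanier phrase structure grammars. -/
def GScb (T : Type) : Set (Set (List T)) :=
  { L | ∃ (N : Type) (_ : Fintype N) (G : GSG N T) (κ : N → ℕ),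
      L = G.CapLang κ }

/-- Matrix languages of finite index. -/
def MATfin (T : Type) : Set (Set (List T)) :=
  { L | ∃ (N : Type) (_ : Fintype N) (G : MG N T) (k : ℕ),
      L = G.Lang ∧ G.Lang ⊆ G.FinLang k }

/-- Capacity-bounded vector languages (erasing rules allowed). -/
def Vcb (T : Type) : Set (Set (List T)) :=
  { L | ∃ (N : Type) (_ : Fintype N) (G : VG N T) (κ : N → ℕ),
      L = G.CapLang κ }

/-- Vector languages of finite index (erasing rules allowed). -/
def Vfin (T : Type) : Set (Set (List T)) :=
  { L | ∃ (N : Type) (_ : Fintype N) (G : VG N T) (k : ℕ),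
      L = G.Lang ∧ G.Lang ⊆ G.FinLang k }

/-- Languages of grammars controlled by cf Petri nets with place capacities. -/
def PNcap (T : Type) : Set (Set (List T)) :=
  { L | ∃ (N : Type) (_ : Fintype N) (G : CFG N T) (κ : N → ℕ),
      L = G.PNLang (fun μ => ∀ A, μ A ≤ κ A) }


/-! ### Derivations -/

theorem symCount_append (A : N) (u v : List (Symb N T)) :
    symCount A (u ++ v) = symCount A u + symCount A v := by
  induction u with
  | nil => simp [symCount]
  | cons s u ih => cases s <;> simp [symCount, ih, add_assoc]

theorem ntCount_append (u v : List (Symb N T)) :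
    ntCount (u ++ v) = ntCount u + ntCount v := by
  induction u with
  | nil => simp [ntCount]
  | cons s u ih => cases s <;> simp [ntCount, ih, add_assoc]

theorem symCount_map_tm (A : N) (x : List T) : symCount A (x.map Symb.tm) = 0 := by
  induction x with
  | nil => rfl
  | cons a x ih => simpa [symCount] using ih

theorem ntCount_map_tm (x : List T) : ntCount (N := N) (x.map Symb.tm) = 0 := by
  induction x with
  | nil => rfl
  | cons a x ih => simpa [ntCount] using ih

theorem ntCount_eq_sum_symCount [Fintype N] (u : List (Symb N T)) :
    ntCount u = ∑ A, symCount A u := by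
  induction u with
  | nil => simp [ntCount, symCount]
  | cons s u ih =>
    cases s with
    | nt A =>
      simp only [ntCount, symCount, ih, Finset.sum_add_distrib]
      rw [Fintype.sum_eq_single A fun B hB => if_neg hB.symm, if_pos rfl]
    | tm a => simpa [ntCount, symCount] using ih

theorem CapOK.ntCount_le [Fintype N] {κ : N → ℕ} {u : List (Symb N T)} (h : CapOK κ u) :
    ntCount u ≤ ∑ A, κ A := by
  rw [ntCount_eq_sum_symCount]
  exact Finset.sum_le_sum fun A _ => h A

theorem DerivP.trans {P : List (Symb N T) → Prop} {π ρ : List (N × List (Symb N T))}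
    {u v w : List (Symb N T)} (h₁ : DerivP P π u v) (h₂ : DerivP P ρ v w) :
    DerivP P (π ++ ρ) u w := by
  induction h₁ with
  | nil u _ => exact h₂
  | cons hu hr _ ih => exact DerivP.cons hu hr (ih h₂)

theorem DerivP.of_append {P : List (Symb N T) → Prop} {π ρ : List (N × List (Symb N T))}
    {u w : List (Symb N T)} (h : DerivP P (π ++ ρ) u w) :
    ∃ v, DerivP P π u v ∧ DerivP P ρ v w := by
  induction π generalizing u with
  | nil =>
    refine ⟨u, DerivP.nil u ?_, h⟩
    cases h <;> assumption
  | cons r π ih =>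
    cases h with
    | cons hu hr h =>
      obtain ⟨v, h₁, h₂⟩ := ih h
      exact ⟨v, DerivP.cons hu hr h₁, h₂⟩

theorem DerivP.mono {P Q : List (Symb N T) → Prop} (hPQ : ∀ u, P u → Q u)
    {π : List (N × List (Symb N T))} {u v : List (Symb N T)} (h : DerivP P π u v) :
    DerivP Q π u v := by
  induction h with
  | nil u hu => exact DerivP.nil u (hPQ _ hu)
  | cons hu hr _ ih => exact DerivP.cons (hPQ _ hu) hr ih

/-- Total number of nonterminal occurrences on the right-hand sides of a rule sequence. -/
def ruleWeight (π : List (N × List (Symb N T))) : ℕ :=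
  (π.map fun r => ntCount r.2).sum

theorem DerivP.bounded {π : List (N × List (Symb N T))} {u v : List (Symb N T)} {k : ℕ}
    (h : DerivP (fun _ => True) π u v) (hk : ntCount u + ruleWeight π ≤ k) :
    DerivP (fun w => ntCount w ≤ k) π u v := by
  induction h with
  | nil u _ => exact DerivP.nil u (by omega)
  | @cons r π u v w _ hr _ ih =>
    simp only [ruleWeight, List.map_cons, List.sum_cons] at hk ih
    refine DerivP.cons (by omega) hr (ih ?_)
    obtain ⟨x, y, rfl, rfl⟩ := hr
    simp only [ntCount_append, ntCount] at hk ⊢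
    omega

/-! ### Renaming nonterminals -/

/-- Renaming of nonterminals in a symbol. -/
def renameSymb {N' : Type} (f : N → N') : Symb N T → Symb N' T
  | Symb.nt A => Symb.nt (f A)
  | Symb.tm a => Symb.tm a

/-- Renaming of nonterminals in a context-free rule. -/
def renameRule {N' : Type} (f : N → N') (r : N × List (Symb N T)) : N' × List (Symb N' T) :=
  (f r.1, r.2.map (renameSymb f))

theorem ntCount_rename {N' : Type} (f : N → N') (u : List (Symb N T)) :
    ntCount (u.map (renameSymb f)) = ntCount u := by
  induction u with
  | nil => rfl
  | cons s u ih => cases s <;> simp [ntCount, renameSymb, ih]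

theorem map_rename_tm {N' : Type} (f : N → N') (w : List T) :
    (w.map Symb.tm).map (renameSymb f) = w.map Symb.tm := by
  simp [renameSymb]

theorem DerivP.rename {N' : Type} (f : N → N') {P : List (Symb N T) → Prop}
    {Q : List (Symb N' T) → Prop} (hPQ : ∀ u, P u → Q (u.map (renameSymb f)))
    {π : List (N × List (Symb N T))} {u v : List (Symb N T)} (h : DerivP P π u v) :
    DerivP Q (π.map (renameRule f)) (u.map (renameSymb f)) (v.map (renameSymb f)) := by
  induction h with
  | nil u hu => exact DerivP.nil _ (hPQ _ hu)
  | cons hu hr _ ih =>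
    refine DerivP.cons (hPQ _ hu) ?_ ih
    obtain ⟨x, y, rfl, rfl⟩ := hr
    exact ⟨x.map (renameSymb f), y.map (renameSymb f), by simp [renameRule, renameSymb],
      by simp [renameRule]⟩

open Classical in
/-- Renaming of nonterminals in a matrix grammar. -/
noncomputable def MG.rename {N' : Type} (f : N → N') (G : MG N T) : MG N' T where
  start := f G.start
  mats := G.mats.image (List.map (renameRule f))

theorem MG.lang_subset_lang_rename {N' : Type} (f : N → N') (G : MG N T) :
    G.Lang ⊆ (G.rename f).Lang := by
  classical
  rintro w ⟨ms, hms, hd⟩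
  refine ⟨ms.map (List.map (renameRule f)), ?_, ?_⟩
  · intro m hm
    obtain ⟨m', hm', rfl⟩ := List.mem_map.1 hm
    exact Finset.mem_image_of_mem _ (hms _ hm')
  · have := hd.rename f (Q := fun _ => True) (fun _ _ => trivial)
    rwa [map_rename_tm, List.map_flatten] at this

theorem MG.finLang_subset_finLang_rename {N' : Type} (f : N → N') (G : MG N T) (k : ℕ) :
    G.FinLang k ⊆ (G.rename f).FinLang k := by
  classical
  rintro w ⟨ms, hms, hd⟩
  refine ⟨ms.map (List.map (renameRule f)), ?_, ?_⟩
  · intro m hm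
    obtain ⟨m', hm', rfl⟩ := List.mem_map.1 hm
    exact Finset.mem_image_of_mem _ (hms _ hm')
  · have := hd.rename f (Q := fun u => ntCount u ≤ k)
      (fun u hu => (ntCount_rename f u).trans_le hu)
    rwa [map_rename_tm, List.map_flatten] at this

/-- The nonterminals occurring in a matrix grammar. -/
def MG.support (G : MG N T) : Set N :=
  {G.start} ∪ ⋃ m ∈ G.mats, ⋃ r ∈ {r | r ∈ m}, ({r.1} ∪ Symb.nt ⁻¹' {s | s ∈ r.2})

theorem MG.finite_support (G : MG N T) : G.support.Finite := by
  refine (Set.finite_singleton _).union (G.mats.finite_toSet.biUnion fun m _ => ?_)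
  refine (List.finite_toSet m).biUnion fun r _ => (Set.finite_singleton _).union ?_
  exact (List.finite_toSet r.2).preimage (fun _ _ _ _ h => Symb.nt.inj h)

theorem MG.rename_rename_of_leftInvOn {N' : Type} {f : N → N'} {g : N' → N} {G : MG N T}
    (h : Set.LeftInvOn g f G.support) : (G.rename f).rename g = G := by
  classical
  obtain ⟨S, M⟩ := G
  have hr : ∀ m ∈ M, ∀ r ∈ m, renameRule g (renameRule f r) = r := by
    rintro m hm ⟨A, l⟩ hr
    have hmem : ∀ B, (B = A ∨ Symb.nt B ∈ l) → g (f B) = B := fun B hB =>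
      h (Or.inr (Set.mem_biUnion hm (Set.mem_biUnion hr hB)))
    simp only [renameRule, List.map_map, hmem A (Or.inl rfl), Prod.mk.injEq, true_and]
    refine (List.map_congr_left fun s hs => ?_).trans (List.map_id l)
    cases s with
    | nt B => simp [renameSymb, hmem B (Or.inr hs)]
    | tm a => rfl
  have hM : ∀ m ∈ M, (List.map (renameRule g) ∘ List.map (renameRule f)) m = m := by
    intro m hm
    simp only [Function.comp, List.map_map]
    exact (List.map_congr_left (hr m hm)).trans (List.map_id m)
  simp only [MG.rename, Finset.image_image, MG.mk.injEq]
  refine ⟨h (Or.inl rfl), ?_⟩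
  convert Finset.image_congr (g := id) (s := M) hM
  simp

/-- Finiteness of the set of nonterminals is no restriction for matrix grammars. -/
theorem MG.lang_mem_MATfin (G : MG N T) (k : ℕ) (h : G.Lang ⊆ G.FinLang k) :
    G.Lang ∈ MATfin T := by
  classical
  let f : N → G.support := fun A => if hA : A ∈ G.support then ⟨A, hA⟩ else ⟨G.start, Or.inl rfl⟩
  have hf : Set.LeftInvOn Subtype.val f G.support := fun A hA => by simp [f, hA]
  have hL : G.Lang = (G.rename f).Lang := by
    refine (G.lang_subset_lang_rename f).antisymm ?_
    conv_rhs => rw [← MG.rename_rename_of_leftInvOn hf]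
    exact (G.rename f).lang_subset_lang_rename _
  refine ⟨G.support, G.finite_support.fintype, G.rename f, k, hL, ?_⟩
  rw [← hL]
  exact h.trans (G.finLang_subset_finLang_rename f k)

/-! ### Encoded sentential forms

A sentential form is cut into items: single nonterminals and blocks of terminals. Its shape is the
list of items with the contents of the terminal blocks forgotten. In the encoding, the item with
index `i` becomes the terminals it holds followed by the nonterminal `(b, s, i)`, where `s` is the
shape of the whole form and `b` is a bit that flips whenever a matrix is applied. -/

/-- Nonterminals of the simulating matrix grammar. -/
abbrev Tag (N : Type) : Type := Bool × List (Option N) × ℕ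

/-- A nonterminal or a block of terminals. -/
abbrev Item (N T : Type) : Type := N ⊕ List T

/-- The kind of an item. -/
def Item.kind : Item N T → Option N
  | Sum.inl A => some A
  | Sum.inr _ => none

/-- The word represented by an item. -/
def Item.word : Item N T → List (Symb N T)
  | Sum.inl A => [Symb.nt A]
  | Sum.inr x => x.map Symb.tm

/-- The terminals written in front of the tag of an item. -/
def Item.pending : Item N T → List (Symb (Tag N) T)
  | Sum.inl _ => []
  | Sum.inr x => x.map Symb.tm

/-- The item consisting of a single symbol. -/
def Item.ofSymb : Symb N T → Item N T
  | Symb.nt A => Sum.inl A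
  | Symb.tm a => Sum.inr [a]

/-- The shape of a list of items. -/
def shape (E : List (Item N T)) : List (Option N) := E.map Item.kind

/-- The sentential form represented by a list of items. -/
def decode (E : List (Item N T)) : List (Symb N T) := E.flatMap Item.word

/-- The nonterminals recorded in a shape. -/
def shapeWord (T : Type) (s : List (Option N)) : List (Symb N T) :=
  s.flatMap fun o => o.toList.map Symb.nt

/-- The encoding of a list of items, with indices counted from `i`. -/
def encode (b : Bool) (s : List (Option N)) : ℕ → List (Item N T) → List (Symb (Tag N) T)
  | _, [] => []
  | i, e :: E => e.pending ++ Symb.nt (b, s, i) :: encode b s (i + 1) E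

/-- The rules replacing the tags with index `i`, `i + 1`, … by given words. -/
def tagRules (b : Bool) (s : List (Option N)) :
    ℕ → List (List (Symb (Tag N) T)) → List (Tag N × List (Symb (Tag N) T))
  | _, [] => []
  | i, f :: F => ((b, s, i), f) :: tagRules b s (i + 1) F

/-- The result of replacing the tags in an encoding by given words. -/
def fill : List (Item N T) → List (List (Symb (Tag N) T)) → List (Symb (Tag N) T)
  | e :: E, f :: F => e.pending ++ f ++ fill E F
  | _, _ => []

/-- The words consisting of the single tags with index `i`, …, `i + n - 1`. -/
def tagWords (b : Bool) (s : List (Option N)) (i n : ℕ) : List (List (Symb (Tag N) T)) :=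
  (List.range' i n).map fun j => [Symb.nt (b, s, j)]

/-- The matrix turning encodings of shape `p ++ c ++ q` into encodings of shape
`p ++ shape g ++ q`: the part `c` is replaced by `g`, while its terminals remain. -/
def matrix (b : Bool) (p c q : List (Option N)) (g : List (Item N T)) :
    List (Tag N × List (Symb (Tag N) T)) :=
  tagRules b (p ++ c ++ q) 0
    (tagWords (!b) (p ++ shape g ++ q) 0 p.length ++
      (List.replicate (c.length - 1) [] ++ [encode (!b) (p ++ shape g ++ q) p.length g]) ++
      tagWords (!b) (p ++ shape g ++ q) (p.length + g.length) q.length)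

theorem decode_append (E F : List (Item N T)) : decode (E ++ F) = decode E ++ decode F := by
  simp [decode]

theorem shape_append (E F : List (Item N T)) : shape (E ++ F) = shape E ++ shape F := by
  simp [shape]

theorem length_shape (E : List (Item N T)) : (shape E).length = E.length := by
  simp [shape]

theorem decode_map_inl (l : List N) :
    decode (l.map (Sum.inl : N → Item N T)) = l.map Symb.nt := by
  induction l with
  | nil => rfl
  | cons A l ih => simpa [decode, Item.word] using ih

theorem decode_map_ofSymb (u : List (Symb N T)) : decode (u.map Item.ofSymb) = u := by
  induction u with
  | nil => rfl
  | cons s u ih => cases s <;> simpa [decode, Item.word, Item.ofSymb] using ih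

theorem capOK_shapeWord_iff {κ : N → ℕ} (E : List (Item N T)) :
    CapOK κ (shapeWord T (shape E)) ↔ CapOK κ (decode E) := by
  have h : ∀ A, symCount A (shapeWord T (shape E)) = symCount A (decode E) := by
    intro A
    induction E with
    | nil => rfl
    | cons e E ih =>
      simp only [shapeWord, shape, decode, List.map_cons, List.flatMap_cons,
        symCount_append] at ih ⊢
      rw [ih]
      cases e <;> simp [Item.kind, Item.word, symCount, symCount_map_tm]
  simp [CapOK, h]

theorem encode_append (b : Bool) (s : List (Option N)) (i : ℕ) (E F : List (Item N T)) :
    encode b s i (E ++ F) = encode b s i E ++ encode b s (i + E.length) F := by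
  induction E generalizing i with
  | nil => simp [encode]
  | cons e E ih => simp [encode, ih, add_assoc, add_comm 1]

theorem ntCount_encode (b : Bool) (s : List (Option N)) (i : ℕ) (E : List (Item N T)) :
    ntCount (encode b s i E) = E.length := by
  induction E generalizing i with
  | nil => rfl
  | cons e E ih =>
    cases e <;> simp [encode, Item.pending, ntCount_append, ntCount, ih, ntCount_map_tm, add_comm]

theorem Item.nt_notMem_pending (e : Item N T) (t : Tag N) : Symb.nt t ∉ e.pending := by
  cases e <;> simp [Item.pending]

theorem mem_encode {b : Bool} {s : List (Option N)} {i : ℕ} {E : List (Item N T)} {t : Tag N}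
    (h : Symb.nt t ∈ encode b s i E) : ∃ j, i ≤ j ∧ t = (b, s, j) := by
  induction E generalizing i with
  | nil => simp [encode] at h
  | cons e E ih =>
    simp only [encode, List.mem_append, List.mem_cons, Symb.nt.injEq] at h
    rcases h with h | h | h
    · exact absurd h (e.nt_notMem_pending t)
    · exact ⟨i, le_rfl, h⟩
    · obtain ⟨j, hj, rfl⟩ := ih h
      exact ⟨j, by omega, rfl⟩

theorem applyRule_iff_of_notMem {A : N} {f x y v : List (Symb N T)}
    (hx : Symb.nt A ∉ x) (hy : Symb.nt A ∉ y) :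
    applyRule (A, f) (x ++ Symb.nt A :: y) v ↔ v = x ++ f ++ y := by
  constructor
  · rintro ⟨x', y', h, rfl⟩
    obtain ⟨rfl, -, rfl⟩ := (List.append_cons_inj_of_notMem hx hy).1 h
    rfl
  · rintro rfl
    exact ⟨x, y, rfl, rfl⟩

theorem derivP_tagRules_iff {b : Bool} {s : List (Option N)} {i : ℕ} {E : List (Item N T)}
    {F : List (List (Symb (Tag N) T))} {u v : List (Symb (Tag N) T)} (hl : E.length = F.length)
    (hu : ∀ t, Symb.nt (b, t) ∉ u) (hF : ∀ f ∈ F, ∀ t, Symb.nt (b, t) ∉ f) :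
    DerivP (fun _ => True) (tagRules b s i F) (u ++ encode b s i E) v ↔ v = u ++ fill E F := by
  induction F generalizing i E u with
  | nil =>
    obtain rfl := List.length_eq_zero_iff.1 hl
    simp only [tagRules, encode, fill, List.append_nil]
    constructor
    · intro h
      cases h
      rfl
    · rintro rfl
      exact DerivP.nil _ trivial
  | cons f F ih =>
    obtain _ | ⟨e, E⟩ := E
    · simp at hl
    have hx : ∀ t, Symb.nt (b, t) ∉ u ++ e.pending := fun t => by
      simp [hu t, e.nt_notMem_pending]
    have hy : Symb.nt (b, s, i) ∉ encode b s (i + 1) E := fun h => by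
      obtain ⟨j, hj, h⟩ := mem_encode h
      simp only [Prod.mk.injEq, true_and] at h
      omega
    have hxf : ∀ t, Symb.nt (b, t) ∉ u ++ e.pending ++ f := fun t => by
      simp only [List.mem_append, not_or]
      exact ⟨⟨hu t, e.nt_notMem_pending _⟩, hF f (by simp) t⟩
    have ih' := ih (i := i + 1) (E := E) (u := u ++ e.pending ++ f) (by simpa using hl) hxf
      (fun g hg => hF g (by simp [hg]))
    simp only [tagRules, encode, fill]
    rw [← List.append_assoc]
    constructor
    · intro h
      cases h with
      | cons _ hr h =>
        rw [applyRule_iff_of_notMem (hx _) hy] at hr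
        subst hr
        simpa using ih'.1 h
    · rintro rfl
      exact DerivP.cons trivial ((applyRule_iff_of_notMem (hx _) hy).2 rfl)
        (ih'.2 (by simp))

theorem fill_append {E E' : List (Item N T)} {F F' : List (List (Symb (Tag N) T))}
    (h : E.length = F.length) : fill (E ++ E') (F ++ F') = fill E F ++ fill E' F' := by
  induction F generalizing E with
  | nil =>
    obtain rfl := List.length_eq_zero_iff.1 h
    simp [fill]
  | cons f F ih =>
    obtain _ | ⟨e, E⟩ := E
    · simp at h
    simp [fill, ih (E := E) (by simpa using h)]

theorem fill_tagWords (b : Bool) (s : List (Option N)) (i : ℕ) (E : List (Item N T)) :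
    fill E (tagWords b s i E.length) = encode b s i E := by
  induction E generalizing i with
  | nil => rfl
  | cons e E ih => simpa [fill, encode, tagWords, List.range'_succ] using ih (i + 1)

theorem fill_replicate {C : List (Item N T)} (hC : C ≠ []) (f : List (Symb (Tag N) T)) :
    fill C (List.replicate (C.length - 1) [] ++ [f]) = C.flatMap Item.pending ++ f := by
  induction C with
  | nil => exact absurd rfl hC
  | cons e C ih =>
    obtain _ | ⟨e', C⟩ := C
    · simp [fill]
    · simpa [fill, List.replicate_succ] using ih (by simp)

theorem derivP_matrix_iff {b : Bool} {P C Q g : List (Item N T)} {v : List (Symb (Tag N) T)}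
    (hC : C ≠ []) :
    DerivP (fun _ => True) (matrix b (shape P) (shape C) (shape Q) g)
      (encode b (shape (P ++ C ++ Q)) 0 (P ++ C ++ Q)) v ↔
    v = encode (!b) (shape (P ++ g ++ Q)) 0 P ++ (C.flatMap Item.pending ++
      encode (!b) (shape (P ++ g ++ Q)) P.length g) ++
      encode (!b) (shape (P ++ g ++ Q)) (P.length + g.length) Q := by
  have hpos := List.length_pos_iff.2 hC
  have := derivP_tagRules_iff (b := b) (s := shape (P ++ C ++ Q)) (i := 0) (E := P ++ C ++ Q)
    (F := tagWords (!b) (shape (P ++ g ++ Q)) 0 P.length ++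
      (List.replicate (C.length - 1) [] ++ [encode (!b) (shape (P ++ g ++ Q)) P.length g]) ++
      tagWords (!b) (shape (P ++ g ++ Q)) (P.length + g.length) Q.length) (u := []) (v := v)
    (by simp [tagWords]; omega) (by simp) ?_
  · simp only [List.nil_append] at this
    simp only [matrix, ← shape_append, length_shape]
    rw [this, fill_append (by simp [tagWords]; omega), fill_append (by simp [tagWords]),
      fill_tagWords, fill_tagWords, fill_replicate hC]
  · intro f hf t ht
    simp only [tagWords, List.mem_append, List.mem_map, List.mem_replicate,
      List.mem_singleton] at hf
    rcases hf with (⟨j, -, rfl⟩ | ⟨-, rfl⟩ | rfl) | ⟨j, -, rfl⟩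
    · simp at ht
    · simp at ht
    · obtain ⟨j, -, h⟩ := mem_encode ht
      simp at h
    · simp at ht

theorem flatMap_pending_map_inl (l : List N) :
    (l.map (Sum.inl : N → Item N T)).flatMap Item.pending = [] := by
  induction l with
  | nil => rfl
  | cons A l ih => simp [Item.pending]

/-- A matrix replacing nonterminals. -/
theorem derivP_matrix_inl_iff {b : Bool} {P Q g : List (Item N T)} {l : List N}
    {v : List (Symb (Tag N) T)} (hl : l ≠ []) :
    DerivP (fun _ => True) (matrix b (shape P) (l.map some) (shape Q) g)
      (encode b (shape (P ++ l.map Sum.inl ++ Q)) 0 (P ++ l.map Sum.inl ++ Q)) v ↔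
    v = encode (!b) (shape (P ++ g ++ Q)) 0 (P ++ g ++ Q) := by
  have h := derivP_matrix_iff (b := b) (P := P) (C := l.map Sum.inl) (Q := Q) (g := g) (v := v)
    (by simpa using hl)
  have hs : shape (l.map (Sum.inl : N → Item N T)) = l.map some := by
    simp [shape, Item.kind]
  rw [hs] at h
  rw [h, flatMap_pending_map_inl, encode_append, encode_append]
  simp

/-- A matrix merging two adjacent terminal blocks. -/
theorem derivP_matrix_merge_iff {b : Bool} {P Q : List (Item N T)} {x y : List T}
    {v : List (Symb (Tag N) T)} :
    DerivP (fun _ => True) (matrix b (shape P) [none, none] (shape Q) [Sum.inr []])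
      (encode b (shape (P ++ [Sum.inr x, Sum.inr y] ++ Q)) 0
        (P ++ [Sum.inr x, Sum.inr y] ++ Q)) v ↔
    v = encode (!b) (shape (P ++ [Sum.inr (x ++ y)] ++ Q)) 0 (P ++ [Sum.inr (x ++ y)] ++ Q) := by
  have h := derivP_matrix_iff (b := b) (P := P) (C := [Sum.inr x, Sum.inr y]) (Q := Q)
    (g := [Sum.inr []]) (v := v) (by simp)
  have hs : shape (P ++ [Sum.inr []] ++ Q) = shape (P ++ [Sum.inr (x ++ y)] ++ Q) := by
    simp [shape, Item.kind]
  rw [hs] at h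
  refine h.trans ?_
  rw [encode_append, encode_append]
  simp [encode, Item.pending]

/-- The matrix deleting the tag of a single terminal block. -/
theorem derivP_matrix_final_iff {b : Bool} {x : List T} {v : List (Symb (Tag N) T)} :
    DerivP (fun _ => True) (matrix b [] [none] [] [])
      (encode b (shape [(Sum.inr x : Item N T)]) 0 [Sum.inr x]) v ↔ v = x.map Symb.tm := by
  have h := derivP_matrix_iff (b := b) (P := []) (C := [(Sum.inr x : Item N T)]) (Q := [])
    (g := []) (v := v) (by simp)
  refine h.trans ?_
  simp [encode, Item.pending]

theorem eq_of_derivP_matrix {b b' : Bool} {p c q : List (Option N)} {g E : List (Item N T)}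
    {v : List (Symb (Tag N) T)}
    (h : DerivP (fun _ => True) (matrix b p c q g) (encode b' (shape E) 0 E) v) :
    b = b' ∧ p ++ c ++ q = shape E := by
  obtain ⟨F, f, hF⟩ : ∃ f F, tagWords (!b) (p ++ shape g ++ q) 0 p.length ++
      (List.replicate (c.length - 1) [] ++ [encode (!b) (p ++ shape g ++ q) p.length g]) ++
      tagWords (!b) (p ++ shape g ++ q) (p.length + g.length) q.length = f :: F :=
    List.exists_cons_of_ne_nil (by simp)
  rw [matrix, hF, tagRules] at h
  cases h with
  | cons _ hr _ =>
    obtain ⟨x, y, hxy, -⟩ := hr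
    have hmem : Symb.nt (b, p ++ c ++ q, 0) ∈ encode b' (shape E) 0 E := by
      rw [hxy]
      simp
    obtain ⟨j, -, h⟩ := mem_encode hmem
    simp only [Prod.mk.injEq] at h
    exact ⟨h.1, h.2.1⟩

theorem exists_of_shape_eq_append {E : List (Item N T)} {p c q : List (Option N)}
    (h : p ++ c ++ q = shape E) :
    ∃ P C Q, E = P ++ C ++ Q ∧ shape P = p ∧ shape C = c ∧ shape Q = q := by
  obtain ⟨E', Q, rfl, h', rfl⟩ := List.map_eq_append_iff.1 h.symm
  obtain ⟨P, C, rfl, rfl, rfl⟩ := List.map_eq_append_iff.1 h'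
  exact ⟨P, C, Q, rfl, rfl, rfl, rfl⟩

theorem eq_map_inl_of_shape_eq {E : List (Item N T)} {l : List N} (h : shape E = l.map some) :
    E = l.map Sum.inl := by
  induction l generalizing E with
  | nil => simpa [shape] using h
  | cons A l ih =>
    obtain _ | ⟨e, E⟩ := E
    · simp [shape] at h
    simp only [shape, List.map_cons, List.cons.injEq] at h
    cases e with
    | inl B =>
      obtain rfl : B = A := by simpa [Item.kind] using h.1
      rw [ih h.2, List.map_cons]
    | inr x => simp [Item.kind] at h

theorem Item.eq_inr_of_kind_eq_none {e : Item N T} (h : e.kind = none) : ∃ x, e = Sum.inr x := by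
  cases e with
  | inl A => simp [Item.kind] at h
  | inr x => exact ⟨x, rfl⟩

/-! ### Normalized lists of items -/

/-- The terminal blocks of the list are nonempty. -/
def BlocksNonempty (E : List (Item N T)) : Prop := Sum.inr [] ∉ E

theorem exists_of_decode_eq_append_nt {E : List (Item N T)} {x z : List (Symb N T)} {A : N}
    (h : decode E = x ++ Symb.nt A :: z) :
    ∃ P Q, E = P ++ Sum.inl A :: Q ∧ decode P = x ∧ decode Q = z := by
  induction E generalizing x with
  | nil => simp [decode] at h
  | cons e E ih =>
    have h' : e.word ++ decode E = x ++ Symb.nt A :: z := h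
    rcases List.append_eq_append_iff.1 h' with ⟨x', rfl, h₂⟩ | ⟨y, h₁, h₂⟩
    · obtain ⟨P, Q, rfl, rfl, rfl⟩ := ih h₂
      exact ⟨e :: P, Q, rfl, rfl, rfl⟩
    · cases e with
      | inl B =>
        obtain _ | ⟨s, x⟩ := x
        · simp only [Item.word, List.nil_append, List.singleton_append, List.cons.injEq,
            Symb.nt.injEq] at h'
          obtain ⟨rfl, rfl⟩ := h'
          exact ⟨[], E, rfl, rfl, rfl⟩
        · simp only [Item.word, List.cons_append, List.cons.injEq] at h'
          obtain ⟨rfl, h'⟩ := h'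
          obtain ⟨P, Q, rfl, rfl, rfl⟩ := ih h'
          exact ⟨Sum.inl B :: P, Q, rfl, rfl, rfl⟩
      | inr t =>
        obtain _ | ⟨s, y⟩ := y
        · obtain ⟨P, Q, rfl, hP, rfl⟩ := ih (x := []) (by simpa using h₂.symm)
          refine ⟨Sum.inr t :: P, Q, rfl, ?_, rfl⟩
          change Item.word _ ++ decode P = x
          rw [hP, h₁]
          simp
        · simp only [List.cons_append, List.cons.injEq] at h₂
          have : Symb.nt A ∈ Item.word (Sum.inr t : Item N T) := by
            rw [h₁, h₂.1]
            simp
          simp [Item.word] at this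

theorem exists_of_decode_eq_map_nt_append {E : List (Item N T)} {l : List N}
    {y : List (Symb N T)} (hE : BlocksNonempty E) (h : decode E = l.map Symb.nt ++ y) :
    ∃ Q, E = l.map Sum.inl ++ Q ∧ decode Q = y := by
  induction l generalizing E with
  | nil => exact ⟨E, rfl, h⟩
  | cons A l ih =>
    obtain _ | ⟨e, E⟩ := E
    · simp [decode] at h
    have h' : e.word ++ decode E = Symb.nt A :: (l.map Symb.nt ++ y) := h
    cases e with
    | inl B =>
      simp only [Item.word, List.singleton_append, List.cons.injEq, Symb.nt.injEq] at h'
      obtain ⟨Q, rfl, rfl⟩ := ih (E := E) (fun hm => hE (by simp [hm])) h'.2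
      exact ⟨Q, by simp [h'.1], rfl⟩
    | inr x =>
      obtain _ | ⟨a, x⟩ := x
      · simp [BlocksNonempty] at hE
      · simp [Item.word] at h'

theorem exists_of_decode_eq {E : List (Item N T)} {l : List N} {x y : List (Symb N T)}
    (hl : l ≠ []) (hE : BlocksNonempty E) (h : decode E = x ++ l.map Symb.nt ++ y) :
    ∃ P Q, E = P ++ l.map Sum.inl ++ Q ∧ decode P = x ∧ decode Q = y := by
  obtain ⟨A, l, rfl⟩ := List.exists_cons_of_ne_nil hl
  obtain ⟨P, Q, rfl, rfl, hQ⟩ := exists_of_decode_eq_append_nt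
    (x := x) (z := l.map Symb.nt ++ y) (A := A) (by simpa using h)
  obtain ⟨Q, rfl, rfl⟩ := exists_of_decode_eq_map_nt_append
    (fun hm => hE (by simp [hm])) hQ
  exact ⟨P, Q, by simp, rfl, rfl⟩

/-- No two terminal blocks of the list are adjacent. -/
def BlocksSeparated (E : List (Item N T)) : Prop :=
  ¬ ∃ P x y Q, E = P ++ [Sum.inr x, Sum.inr y] ++ Q

theorem BlocksSeparated.of_append {E F : List (Item N T)} (h : BlocksSeparated (E ++ F)) :
    BlocksSeparated F := by
  rintro ⟨P, x, y, Q, rfl⟩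
  exact h ⟨E ++ P, x, y, Q, by simp⟩

theorem BlocksSeparated.length_le : ∀ {E : List (Item N T)}, BlocksSeparated E →
    E.length ≤ 2 * ntCount (decode E) + 1
  | [], _ => by simp
  | Sum.inl A :: E, h => by
    have := BlocksSeparated.length_le (BlocksSeparated.of_append (E := [Sum.inl A]) h)
    have h' : decode (Sum.inl A :: E) = Symb.nt A :: decode E := rfl
    simp only [h', ntCount, List.length_cons]
    omega
  | [Sum.inr x], _ => by simp
  | Sum.inr x :: Sum.inr y :: E, h => absurd ⟨[], x, y, E, rfl⟩ h
  | Sum.inr x :: Sum.inl A :: E, h => by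
    have := BlocksSeparated.length_le (BlocksSeparated.of_append (E := [Sum.inr x, Sum.inl A]) h)
    have h' : decode (Sum.inr x :: Sum.inl A :: E) = x.map Symb.tm ++ Symb.nt A :: decode E := rfl
    simp only [h', ntCount_append, ntCount_map_tm, ntCount, List.length_cons]
    omega

/-! ### The simulating matrix grammar -/

/-- The matrices simulating a capacity-bounded Ginsburg–Spanier grammar on shapes whose length is
at most `M`. -/
inductive SimMatrix (G : GSG N T) (κ : N → ℕ) (M : ℕ) :
    List (Tag N × List (Symb (Tag N) T)) → Prop
  | rule (b : Bool) (p q : List (Option N)) (r : (N × List N) × List (Symb N T)) :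
      p.length ≤ M → q.length ≤ M → r ∈ G.rules →
      CapOK κ (shapeWord T (p ++ (r.1.1 :: r.1.2).map some ++ q)) →
      CapOK κ (shapeWord T (p ++ shape (r.2.map Item.ofSymb) ++ q)) →
      SimMatrix G κ M (matrix b p ((r.1.1 :: r.1.2).map some) q (r.2.map Item.ofSymb))
  | merge (b : Bool) (p q : List (Option N)) : p.length ≤ M → q.length ≤ M →
      SimMatrix G κ M (matrix b p [none, none] q [Sum.inr []])
  | final (b : Bool) : SimMatrix G κ M (matrix b [] [none] [] [])

theorem finite_simMatrix [Finite N] (G : GSG N T) (κ : N → ℕ) (M : ℕ) :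
    {m | SimMatrix G κ M m}.Finite := by
  have hA : {l : List (Option N) | l.length ≤ M}.Finite := List.finite_length_le _ M
  let D : Set (List (Option N) × List (Item N T)) :=
    (fun r : (N × List N) × List (Symb N T) =>
      ((r.1.1 :: r.1.2).map some, r.2.map Item.ofSymb)) '' G.rules ∪
      {([none, none], [Sum.inr []]), ([none], [])}
  have hD : D.Finite := (G.rules.finite_toSet.image _).union (Set.toFinite _)
  refine (((Set.finite_univ (α := Bool)).prod (hA.prod (hA.prod hD))).image
    fun d => matrix d.1 d.2.1 d.2.2.2.1 d.2.2.1 d.2.2.2.2).subset ?_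
  rintro m (⟨b, p, q, r, hp, hq, hr, -, -⟩ | ⟨b, p, q, hp, hq⟩ | b)
  · exact ⟨(b, p, q, _, _), ⟨trivial, hp, hq, Or.inl ⟨r, hr, rfl⟩⟩, rfl⟩
  · exact ⟨(b, p, q, [none, none], [Sum.inr []]),
      ⟨trivial, hp, hq, Or.inr (by simp)⟩, rfl⟩
  · exact ⟨(b, [], [], [none], []), ⟨trivial, by simp, by simp, Or.inr (by simp)⟩, rfl⟩

/-- The matrix grammar simulating a capacity-bounded Ginsburg–Spanier grammar. -/
noncomputable def simMG [Finite N] (G : GSG N T) (κ : N → ℕ) (M : ℕ) : MG (Tag N) T where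
  start := (false, [some G.start], 0)
  mats := (finite_simMatrix G κ M).toFinset

theorem mem_simMG_mats [Finite N] {G : GSG N T} {κ : N → ℕ} {M : ℕ}
    {m : List (Tag N × List (Symb (Tag N) T))} :
    m ∈ (simMG G κ M).mats ↔ SimMatrix G κ M m := by
  simp [simMG]

theorem encode_start [Finite N] (G : GSG N T) (κ : N → ℕ) (M : ℕ) :
    ([Symb.nt (simMG G κ M).start] : List (Symb (Tag N) T)) =
      encode false (shape [(Sum.inl G.start : Item N T)]) 0 [Sum.inl G.start] := rfl

/-- Applying a simulating matrix to an encoding. -/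
theorem SimMatrix.sound {G : GSG N T} {κ : N → ℕ} {M : ℕ}
    {m : List (Tag N × List (Symb (Tag N) T))} (hm : SimMatrix G κ M m) {b : Bool}
    {E : List (Item N T)} {v : List (Symb (Tag N) T)}
    (h : DerivP (fun _ => True) m (encode b (shape E) 0 E) v) :
    (∃ b' E', v = encode b' (shape E') 0 E' ∧
      Relation.ReflTransGen (G.CapStep κ) (decode E) (decode E')) ∨
    ∃ x : List T, v = x.map Symb.tm ∧ decode E = x.map Symb.tm := by
  cases hm with
  | rule b p q r hp hq hr hc hc' =>
    obtain ⟨rfl, hs⟩ := eq_of_derivP_matrix h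
    obtain ⟨P, C, Q, rfl, rfl, hC, rfl⟩ := exists_of_shape_eq_append hs
    obtain rfl := eq_map_inl_of_shape_eq hC
    rw [derivP_matrix_inl_iff (by simp)] at h
    refine Or.inl ⟨_, _, h, Relation.ReflTransGen.single ⟨⟨r, hr, decode P, decode Q, ?_, ?_⟩,
      ?_, ?_⟩⟩
    · simp only [decode_append, decode_map_inl]
    · simp only [decode_append, decode_map_ofSymb]
    · rwa [← capOK_shapeWord_iff, ← hs]
    · rwa [← capOK_shapeWord_iff, shape_append, shape_append]
  | merge b p q hp hq =>
    obtain ⟨rfl, hs⟩ := eq_of_derivP_matrix h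
    obtain ⟨P, C, Q, rfl, rfl, hC, rfl⟩ := exists_of_shape_eq_append hs
    obtain ⟨e₁, e₂, rfl⟩ := List.length_eq_two.1
      (show C.length = 2 by rw [← length_shape, hC]; rfl)
    simp only [shape, List.map_cons, List.map_nil, List.cons.injEq, and_true] at hC
    obtain ⟨x, rfl⟩ := Item.eq_inr_of_kind_eq_none hC.1
    obtain ⟨y, rfl⟩ := Item.eq_inr_of_kind_eq_none hC.2
    rw [derivP_matrix_merge_iff] at h
    refine Or.inl ⟨_, _, h, ?_⟩
    have : decode (P ++ [Sum.inr x, Sum.inr y] ++ Q) = decode (P ++ [Sum.inr (x ++ y)] ++ Q) := by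
      simp [decode, Item.word]
    rw [this]
  | final b =>
    obtain ⟨rfl, hs⟩ := eq_of_derivP_matrix h
    obtain ⟨e, rfl⟩ := List.length_eq_one_iff.1
      (show E.length = 1 by rw [← length_shape, ← hs]; rfl)
    obtain ⟨x, rfl⟩ := Item.eq_inr_of_kind_eq_none (e := e) (by simpa [shape] using hs.symm)
    rw [derivP_matrix_final_iff] at h
    exact Or.inr ⟨x, h, by simp [decode, Item.word]⟩

theorem SimMatrix.not_derivP_map_tm {G : GSG N T} {κ : N → ℕ} {M : ℕ}
    {m : List (Tag N × List (Symb (Tag N) T))} (hm : SimMatrix G κ M m) {x : List T}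
    {v : List (Symb (Tag N) T)} : ¬ DerivP (fun _ => True) m (x.map Symb.tm) v := by
  have hne : m ≠ [] := by
    have htag : ∀ (b : Bool) (s : List (Option N)) (F : List (List (Symb (Tag N) T))),
        F ≠ [] → tagRules b s 0 F ≠ [] := by
      rintro b s (_ | ⟨f, F⟩) hF
      · exact absurd rfl hF
      · simp [tagRules]
    cases hm <;> exact htag _ _ _ (by simp)
  intro h
  cases h with
  | nil => exact hne rfl
  | @cons r _ _ _ _ _ hr _ =>
    obtain ⟨y, z, hyz, -⟩ := hr
    have : Symb.nt r.1 ∈ x.map Symb.tm := by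
      rw [hyz]
      simp
    simp at this

theorem simMG_lang_subset [Finite N] (G : GSG N T) (κ : N → ℕ) (M : ℕ) :
    (simMG G κ M).Lang ⊆ G.CapLang κ := by
  rintro w ⟨ms, hms, hd⟩
  have key : ∀ (b : Bool) (E : List (Item N T)),
      DerivP (fun _ => True) ms.flatten (encode b (shape E) 0 E) (w.map Symb.tm) →
      Relation.ReflTransGen (G.CapStep κ) (decode E) (w.map Symb.tm) := by
    clear hd
    induction ms with
    | nil =>
      intro b E h
      generalize hw : w.map Symb.tm = v at h
      cases h
      have hl := ntCount_encode b (shape E) 0 E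
      rw [← hw, ntCount_map_tm] at hl
      obtain rfl := List.length_eq_zero_iff.1 hl.symm
      obtain rfl : w = [] := by simpa [encode] using hw
      exact Relation.ReflTransGen.refl
    | cons m ms ih =>
      intro b E h
      obtain ⟨v, h₁, h₂⟩ := DerivP.of_append (by simpa using h)
      rcases (mem_simMG_mats.1 (hms m (by simp))).sound h₁ with
        ⟨b', E', rfl, h⟩ | ⟨x, rfl, h⟩
      · exact h.trans (ih (fun m hm => hms m (by simp [hm])) b' E' h₂)
      · rw [h]
        obtain _ | ⟨m', ms⟩ := ms
        · generalize hw : w.map Symb.tm = v at h₂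
          cases h₂
          have hinj : Function.Injective (Symb.tm : T → Symb (Tag N) T) :=
            fun _ _ h => Symb.tm.inj h
          rw [hinj.list_map hw]
        · obtain ⟨v, h₃, -⟩ := DerivP.of_append (by simpa using h₂)
          exact absurd h₃ (mem_simMG_mats.1 (hms m' (by simp))).not_derivP_map_tm
  rw [encode_start] at hd
  exact key _ _ hd

/-- Merging all adjacent terminal blocks. -/
theorem exists_merge_derivation [Finite N] (G : GSG N T) (κ : N → ℕ) {M : ℕ} (b : Bool)
    {E : List (Item N T)} (hE : E.length ≤ M) (hne : BlocksNonempty E) {k : ℕ}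
    (hk : ∀ m ∈ (simMG G κ M).mats, M + ruleWeight m ≤ k) (hMk : M ≤ k) :
    ∃ ms : List (List (Tag N × List (Symb (Tag N) T))), (∀ m ∈ ms, m ∈ (simMG G κ M).mats) ∧
      ∃ b' E', BlocksNonempty E' ∧
      BlocksSeparated E' ∧ decode E' = decode E ∧
      DerivP (fun u => ntCount u ≤ k) ms.flatten (encode b (shape E) 0 E)
        (encode b' (shape E') 0 E') := by
  induction hn : E.length generalizing E b with
  | zero =>
    obtain rfl := List.length_eq_zero_iff.1 hn
    exact ⟨[], by simp, b, [], hne, by simp [BlocksSeparated], rfl,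
      DerivP.nil _ (by simp [encode, ntCount])⟩
  | succ n ih =>
    by_cases hs : BlocksSeparated E
    · exact ⟨[], by simp, b, E, hne, hs, rfl, DerivP.nil _ (by rw [ntCount_encode]; omega)⟩
    · obtain ⟨P, x, y, Q, rfl⟩ := not_not.1 hs
      simp only [List.length_append, List.length_cons, List.length_nil] at hE hn
      have hm : matrix b (shape P) [none, none] (shape Q) [Sum.inr []] ∈ (simMG G κ M).mats :=
        mem_simMG_mats.2 (SimMatrix.merge b _ _ (by rw [length_shape]; omega)
          (by rw [length_shape]; omega))
      have hd := (derivP_matrix_merge_iff (b := b) (P := P) (Q := Q) (x := x) (y := y)).2 rfl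
      have hne' : BlocksNonempty (P ++ [Sum.inr (x ++ y)] ++ Q) := by
        simp only [BlocksNonempty, List.mem_append, List.mem_cons, Sum.inr.injEq,
          List.not_mem_nil, or_false, not_or] at hne ⊢
        refine ⟨⟨hne.1.1, fun h => hne.1.2.1 ?_⟩, hne.2⟩
        exact (List.append_eq_nil_iff.1 h.symm).1.symm
      obtain ⟨ms, hms, b', E', h₁, h₂, h₃, h₄⟩ := ih (!b) (by simp; omega) hne' (by simp; omega)
      refine ⟨_ :: ms, List.forall_mem_cons.2 ⟨hm, hms⟩, b', E', h₁, h₂, ?_, ?_⟩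
      · rw [h₃]
        simp [decode, Item.word]
      · rw [List.flatten_cons]
        refine (hd.bounded ?_).trans h₄
        have := hk _ hm
        rw [ntCount_encode]
        simp only [List.length_append, List.length_cons, List.length_nil]
        omega

theorem capLang_subset_simMG_finLang [Fintype N] (G : GSG N T) (κ : N → ℕ) {M k : ℕ}
    (hM : ∀ r ∈ G.rules, 2 * (∑ A, κ A) + 1 + r.2.length ≤ M) (hMpos : 0 < M)
    (hk : ∀ m ∈ (simMG G κ M).mats, M + ruleWeight m ≤ k) (hMk : M ≤ k) :
    G.CapLang κ ⊆ (simMG G κ M).FinLang k := by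
  have key : ∀ u, Relation.ReflTransGen (G.CapStep κ) [Symb.nt G.start] u →
      ∃ ms : List (List (Tag N × List (Symb (Tag N) T))), (∀ m ∈ ms, m ∈ (simMG G κ M).mats) ∧
        ∃ b E, BlocksNonempty E ∧ BlocksSeparated E ∧
        decode E = u ∧ DerivP (fun u => ntCount u ≤ k) ms.flatten
          [Symb.nt (simMG G κ M).start] (encode b (shape E) 0 E) := by
    intro u hu
    induction hu with
    | refl =>
      refine ⟨[], by simp, false, [Sum.inl G.start], by simp [BlocksNonempty], ?_, rfl,
        DerivP.nil _ ?_⟩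
      · rintro ⟨P, x, y, Q, h⟩
        have := congrArg List.length h
        simp only [List.length_append, List.length_cons, List.length_nil] at this
        omega
      · simp only [ntCount]
        omega
    | tail _ hstep ih =>
      obtain ⟨ms, hms, b, E, hne, hsep, rfl, hd⟩ := ih
      obtain ⟨⟨r, hr, x, y, hu, rfl⟩, hcu, hcv⟩ := hstep
      have hlen := hsep.length_le
      have hcap := hcu.ntCount_le
      obtain ⟨P, Q, rfl, rfl, rfl⟩ := exists_of_decode_eq (by simp) hne hu
      have hrM := hM r hr
      simp only [List.length_append, List.length_map, List.length_cons] at hlen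
      have hv : decode P ++ r.2 ++ decode Q = decode (P ++ r.2.map Item.ofSymb ++ Q) := by
        simp only [decode_append, decode_map_ofSymb]
      have hshape : shape ((r.1.1 :: r.1.2).map (Sum.inl : N → Item N T)) =
          (r.1.1 :: r.1.2).map some := by
        simp [shape, Item.kind]
      have hm : matrix b (shape P) ((r.1.1 :: r.1.2).map some) (shape Q)
          (r.2.map Item.ofSymb) ∈ (simMG G κ M).mats := by
        refine mem_simMG_mats.2 (SimMatrix.rule b _ _ r ?_ ?_ hr ?_ ?_)
        · rw [length_shape]; omega
        · rw [length_shape]; omega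
        · rwa [← hshape, ← shape_append, ← shape_append, capOK_shapeWord_iff]
        · rwa [← shape_append, ← shape_append, capOK_shapeWord_iff, ← hv]
      have hd₁ := (derivP_matrix_inl_iff (b := b) (P := P) (Q := Q) (l := r.1.1 :: r.1.2)
        (g := r.2.map Item.ofSymb) (by simp)).2 rfl
      have hne' : BlocksNonempty (P ++ r.2.map Item.ofSymb ++ Q) := by
        simp only [BlocksNonempty, List.mem_append, not_or] at hne ⊢
        refine ⟨⟨hne.1.1, fun h => ?_⟩, hne.2⟩
        obtain ⟨s, -, hs⟩ := List.mem_map.1 h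
        cases s <;> simp [Item.ofSymb] at hs
      obtain ⟨ms', hms', b', E', h₁, h₂, h₃, h₄⟩ := exists_merge_derivation G κ (!b)
        (by simp only [List.length_append, List.length_map]; omega) hne' hk hMk
      refine ⟨_, List.forall_mem_append.2 ⟨hms, List.forall_mem_cons.2 ⟨hm, hms'⟩⟩, b', E', h₁, h₂,
        h₃.trans hv.symm, ?_⟩
      · rw [List.flatten_append, List.flatten_cons]
        refine hd.trans ((hd₁.bounded ?_).trans h₄)
        have := hk _ hm
        rw [ntCount_encode]
        simp only [List.length_append, List.length_map, List.length_cons]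
        omega
  intro w hw
  obtain ⟨ms, hms, b, E, hne, hsep, hE, hd⟩ := key _ hw
  have hlen := hsep.length_le
  rw [hE, ntCount_map_tm] at hlen
  obtain _ | ⟨e, _ | ⟨e', E⟩⟩ := E
  · obtain rfl : w = [] := by simpa [decode] using hE.symm
    exact ⟨ms, hms, hd⟩
  · cases e with
    | inl A =>
      have := congrArg ntCount hE
      rw [ntCount_map_tm] at this
      simp [decode, Item.word, ntCount] at this
    | inr x =>
      have hinj : Function.Injective (Symb.tm : T → Symb N T) := fun _ _ h => Symb.tm.inj h
      obtain rfl : x = w := hinj.list_map (by simpa [decode, Item.word] using hE)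
      have hm : matrix b [] [none] [] [] ∈ (simMG G κ M).mats :=
        mem_simMG_mats.2 (SimMatrix.final b)
      have hd₁ := (derivP_matrix_final_iff (N := N) (b := b) (x := x)).2 rfl
      refine ⟨_, List.forall_mem_append.2 ⟨hms, List.forall_mem_singleton.2 hm⟩, ?_⟩
      · rw [List.flatten_append, List.flatten_singleton]
        refine hd.trans (hd₁.bounded ?_)
        have := hk _ hm
        rw [ntCount_encode]
        simp only [List.length_cons, List.length_nil]
        omega
  · simp at hlen

/-- GS_cb ⊆ MAT_fin. -/
theorem GScb_subset_MATfin (T : Type) : GScb T ⊆ MATfin T := by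
  rintro _ ⟨N, _, G, κ, rfl⟩
  let M := 2 * (∑ A, κ A) + 1 + ∑ r ∈ G.rules, r.2.length
  let k := M + ∑ m ∈ (simMG G κ M).mats, ruleWeight m
  have hsub : G.CapLang κ ⊆ (simMG G κ M).FinLang k := by
    refine capLang_subset_simMG_finLang G κ (fun r hr => ?_) (by omega) (fun m hm => ?_)
      (Nat.le_add_right _ _)
    · exact Nat.add_le_add_left
        (Finset.single_le_sum (f := fun r => r.2.length) (fun _ _ => Nat.zero_le _) hr) _
    · exact Nat.add_le_add_left
        (Finset.single_le_sum (f := ruleWeight) (fun _ _ => Nat.zero_le _) hm) _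
  have hfin : (simMG G κ M).FinLang k ⊆ (simMG G κ M).Lang := by
    rintro w ⟨ms, hms, hd⟩
    exact ⟨ms, hms, hd.mono fun _ _ => trivial⟩
  have hL : G.CapLang κ = (simMG G κ M).Lang :=
    (hsub.trans hfin).antisymm (simMG_lang_subset G κ M)
  rw [hL]
  exact MG.lang_mem_MATfin _ k (hL ▸ hsub)

end CapGram
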